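/- Let ℂ₊ := {z ∈ ℂ : Im z > 0}, take s ∈ ℝ, and define T_s : Hol(ℂ₊) → Hol(ℂ₊) by (T_s f)(z) := z^{−s} · f(−1/z), where z^{−s} = exp(−s·Log z) is the principal power (well defined and holomorphic on ℂ₊, and −1/z ∈ ℂ₊ for z ∈ ℂ₊). Let V be a proper closed linear subspace of Hol(ℂ₊) which is invariant under all the composition operators f ↦ (z ↦ f(z + x)) for x ∈ ℝ and f ↦ (z ↦ f(λz)) for λ > 0. Then V is invariant under T_s if and only if V = {0}, or s is an integer with s ≤ 0 and V = 𝒫^{1−s}, the space of restrictions to ℂ₊ of polynomials of degree ≤ −s. -/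

import Mathlib

noncomputable section

open Complex

/-- The upper half-plane `ℂ₊`. -/
def CPos : Set ℂ := {z | 0 < z.im}

/-- Translation `z ↦ z + x` of the upper half-plane. -/
def transH (x : ℝ) (z : ↥CPos) : ↥CPos :=
  ⟨(z : ℂ) + (x : ℂ), by
    have hz : 0 < (z : ℂ).im := z.2
    show 0 < ((z : ℂ) + (x : ℂ)).im
    simpa using hz⟩

/-- Dilation `z ↦ λ z` of the upper half-plane, `λ > 0`. -/
def dilH (l : ℝ) (hl : 0 < l) (z : ↥CPos) : ↥CPos :=
  ⟨(l : ℂ) * (z : ℂ), by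
    have hz : 0 < (z : ℂ).im := z.2
    show 0 < ((l : ℂ) * (z : ℂ)).im
    simpa [Complex.mul_im] using mul_pos hl hz⟩

/-- The inversion `z ↦ -1/z` of the upper half-plane. -/
def invH (z : ↥CPos) : ↥CPos :=
  ⟨-1 / (z : ℂ), by
    have hz : 0 < (z : ℂ).im := z.2
    have hz0 : (z : ℂ) ≠ 0 := by
      intro h
      rw [h] at hz
      simp at hz
    show 0 < (-1 / (z : ℂ)).im
    have : (-1 / (z : ℂ)).im = (z : ℂ).im / Complex.normSq (z : ℂ) := by
      rw [neg_div, one_div, Complex.neg_im, Complex.inv_im, neg_div, neg_neg]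
    rw [this]
    exact div_pos hz (Complex.normSq_pos.mpr hz0)⟩

/-- A function on `ℂ₊` is holomorphic if it is the restriction of a function
holomorphic on `ℂ₊`. -/
def HoloOnH (f : ↥CPos → ℂ) : Prop :=
  ∃ F : ℂ → ℂ, DifferentiableOn ℂ F CPos ∧ ∀ z : ↥CPos, F ↑z = f z

/-- Membership in the closure of a set of functions on `ℂ₊` for the topology of
uniform convergence on compact subsets. -/
def MemClosureH (S : Set (↥CPos → ℂ)) (f : ↥CPos → ℂ) : Prop :=
  ∀ K : Set ↥CPos, IsCompact K → ∀ ε : ℝ, 0 < ε → ∃ g ∈ S, ∀ z ∈ K, ‖f z - g z‖ ≤ ε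

/-- `𝒫^k`: restrictions to `ℂ₊` of polynomials of degree `< k`. -/
def PolyLtH (k : ℕ) : Set (↥CPos → ℂ) :=
  {f | ∃ p : Polynomial ℂ, p.degree < (k : ℕ) ∧ ∀ z : ↥CPos, f z = p.eval ↑z}


/-- The Taylor coefficients of `F` at `I`. -/
def taylorCoeffI (F : ℂ → ℂ) (n : ℕ) : ℂ := (n.factorial : ℂ)⁻¹ * iteratedDeriv n F I

lemma ball_I_subset_CPos : Metric.ball I 1 ⊆ CPos := by
  intro z hz
  have h1 : ‖z - I‖ < 1 := by simpa [dist_eq_norm] using hz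
  have h2 : |(z - I).im| ≤ ‖z - I‖ := abs_im_le_norm _
  have h3 := (abs_lt.1 (h2.trans_lt h1)).1
  simp only [sub_im, I_im] at h3
  show 0 < z.im
  linarith

lemma isOpen_CPos : IsOpen CPos := isOpen_lt continuous_const continuous_im

lemma isPreconnected_CPos : IsPreconnected CPos :=
  (convex_halfSpace_im_gt 0).isPreconnected

lemma hasSum_taylorCoeffI {F : ℂ → ℂ} (hF : DifferentiableOn ℂ F CPos) {z : ℂ}
    (hz : ‖z - I‖ < 1) : HasSum (fun n => taylorCoeffI F n * (z - I) ^ n) (F z) := by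
  have hz' : z ∈ Metric.ball I 1 := by simpa [dist_eq_norm] using hz
  convert! hasSum_taylorSeries_on_ball (hF.mono ball_I_subset_CPos) hz' using 2 with n
  simp only [taylorCoeffI, smul_eq_mul]
  ring

lemma summable_norm_taylorCoeffI {F : ℂ → ℂ} (hF : DifferentiableOn ℂ F CPos) {r : ℝ}
    (hr0 : 0 ≤ r) (hr : r < 1) : Summable (fun n => ‖taylorCoeffI F n‖ * r ^ n) := by
  have h := (hasSum_taylorCoeffI hF (z := I + r) (by simpa [abs_of_nonneg hr0] using hr)).summable
  simpa [abs_of_nonneg hr0] using h.norm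

section

variable {X : Type*} [TopologicalSpace X] [CompactSpace X]

lemma exists_norm_smul_sub_I_lt_one (ι : C(X, ℂ)) (hι : ∀ t, 0 < (ι t).im) :
    ∃ L > 0, ∀ l : ℝ, 0 < l → l ≤ L → ‖(l : ℂ) • ι - algebraMap ℂ C(X, ℂ) I‖ < 1 := by
  obtain ⟨d, hd, hdι⟩ : ∃ d > 0, ∀ t, d ≤ (ι t).im := by
    rcases isEmpty_or_nonempty X with h | h
    · exact ⟨1, one_pos, fun t => h.elim t⟩
    · obtain ⟨t, -, ht⟩ := isCompact_univ.exists_isMinOn (f := fun t => (ι t).im)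
        Set.univ_nonempty (by fun_prop)
      exact ⟨_, hι t, fun s => ht (Set.mem_univ s)⟩
  refine ⟨d / (‖ι‖ ^ 2 + 1), by positivity, fun l hl hlL => ?_⟩
  rw [ContinuousMap.norm_lt_iff _ one_pos]
  intro t
  have h1 : l * (‖ι‖ ^ 2 + 1) ≤ d := (le_div_iff₀ (by positivity)).1 hlL
  have h2 : ‖ι t‖ ^ 2 ≤ ‖ι‖ ^ 2 := by
    gcongr
    exact ι.norm_coe_le_norm t
  have h3 := hdι t
  rw [← sq_lt_one_iff₀ (norm_nonneg _)]
  rw [← normSq_eq_norm_sq, normSq_apply] at h2 ⊢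
  simp [Algebra.algebraMap_eq_smul_one]
  nlinarith [mul_le_mul_of_nonneg_left h2 (sq_nonneg l), mul_le_mul_of_nonneg_left h1 hl.le,
    mul_le_mul_of_nonneg_left h3 hl.le, mul_pos hl hl, mul_pos hl hd]

variable [Nonempty X]

lemma summable_taylorCoeffI_smul_pow {F : ℂ → ℂ} (hF : DifferentiableOn ℂ F CPos)
    {v : C(X, ℂ)} (hv : ‖v‖ < 1) : Summable (fun n => taylorCoeffI F n • v ^ n) := by
  refine Summable.of_norm_bounded (summable_norm_taylorCoeffI hF (norm_nonneg v) hv) fun n => ?_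
  rw [norm_smul]
  gcongr
  exact norm_pow_le v n

lemma tsum_taylorCoeffI_smul_pow_apply {F : ℂ → ℂ} (hF : DifferentiableOn ℂ F CPos)
    {v : C(X, ℂ)} (hv : ‖v‖ < 1) (t : X) :
    (∑' n, taylorCoeffI F n • v ^ n) t = F (v t + I) := by
  have h1 := (summable_taylorCoeffI_smul_pow hF hv).hasSum.mapL (ContinuousMap.evalCLM ℂ t)
  have h2 := hasSum_taylorCoeffI hF (z := v t + I)
    (by simpa using (v.norm_coe_le_norm t).trans_lt hv)
  refine HasSum.unique (L := .unconditional ℕ) (f := fun n => taylorCoeffI F n * (v t) ^ n) ?_ ?_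
  · simpa using h1
  · simpa using h2

variable {E : Type*} [NormedAddCommGroup E] [NormedSpace ℂ E] [CompleteSpace E]

/-- If a continuous linear map kills all real affine reparametrisations of `F`, then it also
kills the complex ones `F (l z + I)` with `l > 0` small. -/
lemma map_eq_zero_of_real_affine {F : ℂ → ℂ} (hF : DifferentiableOn ℂ F CPos)
    (ι : C(X, ℂ)) (φ : C(X, ℂ) →L[ℂ] E) {l : ℝ}
    (hl : ‖(l : ℂ) • ι - algebraMap ℂ C(X, ℂ) I‖ < 1) (hl' : ‖(l : ℂ) • ι‖ < 1)
    (hφ : ∀ (x : ℝ) (u : C(X, ℂ)), (∀ t, u t = F (l * ι t + x)) → φ u = 0) :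
    φ (∑' n, taylorCoeffI F n • ((l : ℂ) • ι) ^ n) = 0 := by
  set v : ℂ → C(X, ℂ) := fun w => (l : ℂ) • ι + algebraMap ℂ C(X, ℂ) (w - I) with hv
  have hvd : Differentiable ℂ v := by
    simp only [hv, Algebra.algebraMap_eq_smul_one]
    fun_prop
  obtain ⟨r, hr, hr1⟩ := exists_between (max_lt hl hl')
  rw [max_lt_iff] at hr
  have hr0 : 0 ≤ r := (norm_nonneg _).trans hr.1.le
  set W : Set ℂ := {w | ‖v w‖ < r} with hW
  have hWo : IsOpen W := isOpen_lt hvd.continuous.norm continuous_const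
  have hWc : Convex ℝ W := by
    have : W = (fun w => algebraMap ℂ C(X, ℂ) w) ⁻¹'
        Metric.ball (algebraMap ℂ C(X, ℂ) I - (l : ℂ) • ι) r := by
      ext w
      simp only [hW, hv, Set.mem_ofPred_eq, Set.mem_preimage, mem_ball_iff_norm, map_sub]
      congr! 2
      abel
    rw [this]
    exact (convex_ball _ _).is_linear_preimage
      ((Algebra.linearMap ℂ C(X, ℂ)).restrictScalars ℝ).isLinear
  have h0W : (0 : ℂ) ∈ W := by
    simpa [hW, hv, ← sub_eq_add_neg] using hr.1
  have hIW : I ∈ W := by simpa [hW, hv] using hr.2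
  have hsum : ∀ w ∈ W, φ (∑' n, taylorCoeffI F n • v w ^ n) =
      ∑' n, taylorCoeffI F n • φ (v w ^ n) := by
    intro w hw
    rw [φ.map_tsum (summable_taylorCoeffI_smul_pow hF (lt_trans hw hr1))]
    simp
  have hdiff : DifferentiableOn ℂ (fun w => ∑' n, taylorCoeffI F n • φ (v w ^ n)) W := by
    refine differentiableOn_tsum_of_summable_norm
      (u := fun n => ‖φ‖ * (‖taylorCoeffI F n‖ * r ^ n))
      ((summable_norm_taylorCoeffI hF hr0 hr1).mul_left _) (fun n => ?_) hWo fun n w hw => ?_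
    · have h1 : Differentiable ℂ fun w => v w ^ n := hvd.pow n
      exact ((φ.differentiable.comp h1).const_smul _).differentiableOn
    · rw [norm_smul, mul_left_comm]
      gcongr
      refine (φ.le_opNorm _).trans ?_
      gcongr
      exact (norm_pow_le _ _).trans (pow_le_pow_left₀ (norm_nonneg _) (le_of_lt hw) n)
  have hreal : ∀ x : ℝ, (x : ℂ) ∈ W → ∑' n, taylorCoeffI F n • φ (v x ^ n) = 0 := by
    intro x hx
    rw [← hsum x hx]
    refine hφ x _ fun t => ?_
    rw [tsum_taylorCoeffI_smul_pow_apply hF (lt_trans hx hr1)]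
    simp [hv, Algebra.algebraMap_eq_smul_one]
    congr 1
    ring
  have hfreq : ∃ᶠ w in nhdsWithin (0 : ℂ) {0}ᶜ, ∑' n, taylorCoeffI F n • φ (v w ^ n) = 0 := by
    have ht : Filter.Tendsto (fun x : ℝ => (x : ℂ)) (nhdsWithin 0 {0}ᶜ) (nhdsWithin 0 {0}ᶜ) := by
      refine tendsto_nhdsWithin_of_tendsto_nhds_of_eventually_within _ ?_ ?_
      · exact (continuous_ofReal.tendsto' 0 0 (by simp)).mono_left nhdsWithin_le_nhds
      · filter_upwards [self_mem_nhdsWithin] with x hx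
        simpa using hx
    refine ht.frequently (Filter.Eventually.frequently ?_)
    have h4 : ∀ᶠ x : ℝ in nhds 0, (x : ℂ) ∈ W :=
      (continuous_ofReal.tendsto' (0 : ℝ) (0 : ℂ) (by simp)).eventually (hWo.mem_nhds h0W)
    filter_upwards [h4.filter_mono nhdsWithin_le_nhds] with x hx using hreal x hx
  have := (hdiff.analyticOnNhd hWo).eqOn_zero_of_preconnected_of_frequently_eq_zero
    hWc.isPreconnected h0W hfreq hIW
  have h5 := hsum I hIW
  simp only [Pi.zero_apply] at this
  rw [this] at h5
  simpa [hv] using h5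

/-- If a continuous linear map kills all real affine reparametrisations of `F`, then it kills the
monomials whose exponent is that of a nonzero Taylor coefficient of `F`. -/
lemma taylorCoeffI_smul_map_pow_eq_zero {F : ℂ → ℂ} (hF : DifferentiableOn ℂ F CPos)
    (ι : C(X, ℂ)) (hι : ∀ t, 0 < (ι t).im) (φ : C(X, ℂ) →L[ℂ] E)
    (hφ : ∀ (l x : ℝ) (u : C(X, ℂ)), 0 < l → (∀ t, u t = F (l * ι t + x)) → φ u = 0) (n : ℕ) :
    taylorCoeffI F n • φ (ι ^ n) = 0 := by
  obtain ⟨L, hL, hLι⟩ := exists_norm_smul_sub_I_lt_one ι hι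
  have hsmall : ∀ᶠ c : ℂ in nhds 0, ‖c • ι‖ < 1 := by
    have : Continuous fun c : ℂ => ‖c • ι‖ := by fun_prop
    exact this.tendsto' 0 0 (by simp) |>.eventually_lt_const one_pos
  let p : FormalMultilinearSeries ℂ ℂ E := fun n =>
    ContinuousMultilinearMap.mkPiRing ℂ (Fin n) (taylorCoeffI F n • φ (ι ^ n))
  have hp : HasFPowerSeriesAt (fun c : ℂ => φ (∑' n, taylorCoeffI F n • (c • ι) ^ n)) p 0 := by
    rw [hasFPowerSeriesAt_iff]
    filter_upwards [hsmall] with c hc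
    have := (summable_taylorCoeffI_smul_pow hF hc).hasSum.mapL φ
    rw [zero_add]
    convert! this using 2 with m
    simp [p, FormalMultilinearSeries.coeff, smul_pow, smul_comm (c ^ m)]
  have hfreq : ∃ᶠ c in nhdsWithin (0 : ℂ) {0}ᶜ,
      φ (∑' n, taylorCoeffI F n • (c • ι) ^ n) = 0 := by
    have ht : Filter.Tendsto (fun x : ℝ => (x : ℂ)) (nhdsWithin 0 (Set.Ioi 0))
        (nhdsWithin 0 {0}ᶜ) := by
      refine tendsto_nhdsWithin_of_tendsto_nhds_of_eventually_within _ ?_ ?_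
      · exact (continuous_ofReal.tendsto' 0 0 (by simp)).mono_left nhdsWithin_le_nhds
      · filter_upwards [self_mem_nhdsWithin] with x hx
        simpa using (ne_of_gt hx)
    refine ht.frequently (Filter.Eventually.frequently ?_)
    have h4 : ∀ᶠ x : ℝ in nhds 0, ‖(x : ℂ) • ι‖ < 1 :=
      (continuous_ofReal.tendsto' (0 : ℝ) (0 : ℂ) (by simp)).eventually hsmall
    filter_upwards [h4.filter_mono nhdsWithin_le_nhds, Ioc_mem_nhdsGT hL] with l hl1 hl2
    exact map_eq_zero_of_real_affine hF ι φ (hLι l hl2.1 hl2.2) hl1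
      fun x u hu => hφ l x u hl2.1 hu
  have hzero := hp.eq_zero_of_eventually
    (hp.analyticAt.frequently_zero_iff_eventually_zero.1 hfreq)
  have := congrArg (fun q : FormalMultilinearSeries ℂ ℂ E => q.coeff n) hzero
  simpa [p, FormalMultilinearSeries.coeff] using this

end

/-- The monomial `z ↦ z ^ n` on the upper half-plane. -/
def monoH (n : ℕ) : ↥CPos → ℂ := fun z => (z : ℂ) ^ n

lemma holoOnH_monoH (n : ℕ) : HoloOnH (monoH n) :=
  ⟨fun z => z ^ n, by fun_prop, fun _ => rfl⟩

lemma monoH_mem_of_taylorCoeffI_ne_zero {V : Submodule ℂ (↥CPos → ℂ)}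
    (hclosed : ∀ f, HoloOnH f → MemClosureH V f → f ∈ V)
    (htrans : ∀ f ∈ V, ∀ x : ℝ, (fun z => f (transH x z)) ∈ V)
    (hdil : ∀ f ∈ V, ∀ (l : ℝ) (hl : 0 < l), (fun z => f (dilH l hl z)) ∈ V)
    {f : ↥CPos → ℂ} (hf : f ∈ V) {F : ℂ → ℂ} (hF : DifferentiableOn ℂ F CPos)
    (hFf : ∀ z : ↥CPos, F z = f z) {n : ℕ} (hn : taylorCoeffI F n ≠ 0) : monoH n ∈ V := by
  refine hclosed _ (holoOnH_monoH n) fun K hK ε hε => ?_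
  rcases K.eq_empty_or_nonempty with rfl | hKne
  · exact ⟨0, V.zero_mem, by simp⟩
  have := isCompact_iff_compactSpace.1 hK
  have := hKne.to_subtype
  let ι : C(K, ℂ) := ⟨fun z => ((z : ↥CPos) : ℂ), by fun_prop⟩
  let U : Submodule ℂ C(K, ℂ) :=
    { carrier := {u | ∃ g ∈ V, ∀ z : K, u z = g z}
      add_mem' := by
        rintro a b ⟨g, hg, hag⟩ ⟨h, hh, hbh⟩
        exact ⟨g + h, V.add_mem hg hh, fun z => by simp [hag, hbh]⟩
      zero_mem' := ⟨0, V.zero_mem, fun z => rfl⟩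
      smul_mem' := by
        rintro c a ⟨g, hg, hag⟩
        exact ⟨c • g, V.smul_mem c hg, fun z => by simp [hag]⟩ }
  have : IsClosed (U.topologicalClosure : Set C(K, ℂ)) := U.isClosed_topologicalClosure
  have hker := taylorCoeffI_smul_map_pow_eq_zero hF ι (fun z => z.1.2)
    U.topologicalClosure.mkQL (fun l x u hl hu => by
      have hmem : u ∈ U := ⟨_, hdil _ (htrans f hf x) l hl, fun z => by
        rw [hu, ← hFf]
        simp [ι, transH, dilH]⟩
      exact (Submodule.Quotient.mk_eq_zero _).2 (U.le_topologicalClosure hmem)) n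
  have hmem : ι ^ n ∈ closure (U : Set C(K, ℂ)) :=
    (Submodule.Quotient.mk_eq_zero U.topologicalClosure).1 ((smul_eq_zero.1 hker).resolve_left hn)
  obtain ⟨u, ⟨g, hg, hug⟩, hu⟩ := Metric.mem_closure_iff.1 hmem ε hε
  refine ⟨g, hg, fun z hz => ?_⟩
  rw [dist_eq_norm] at hu
  have := ((ι ^ n - u).norm_coe_le_norm ⟨z, hz⟩).trans hu.le
  simpa [hug, ι, monoH] using this

lemma eval_mem_of_monoH_mem {V : Submodule ℂ (↥CPos → ℂ)} {p : Polynomial ℂ}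
    (h : ∀ n ∈ p.support, monoH n ∈ V) : (fun z : ↥CPos => p.eval (z : ℂ)) ∈ V := by
  have : (fun z : ↥CPos => p.eval (z : ℂ)) = ∑ n ∈ p.support, p.coeff n • monoH n := by
    ext z
    simp [Polynomial.eval_eq_sum, Polynomial.sum, monoH]
  rw [this]
  exact V.sum_mem fun n hn => V.smul_mem _ (h n hn)

/-- The polynomials are dense in `Hol(ℂ₊)`. -/
lemma mem_of_forall_monoH_mem {V : Submodule ℂ (↥CPos → ℂ)}
    (hclosed : ∀ f, HoloOnH f → MemClosureH V f → f ∈ V) (h : ∀ n, monoH n ∈ V)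
    {f : ↥CPos → ℂ} (hf : HoloOnH f) : f ∈ V := by
  refine hclosed f hf fun K hK ε hε => ?_
  obtain ⟨F, hF, hFf⟩ := hf
  rcases K.eq_empty_or_nonempty with rfl | hKne
  · exact ⟨0, V.zero_mem, by simp⟩
  have := isCompact_iff_compactSpace.1 hK
  have := hKne.to_subtype
  let ι : C(K, ℂ) := ⟨fun z => ((z : ↥CPos) : ℂ), by fun_prop⟩
  obtain ⟨l, hl, hlι⟩ := exists_norm_smul_sub_I_lt_one ι fun z => z.1.2
  specialize hlι l hl le_rfl
  have hl0 : (l : ℂ) ≠ 0 := by exact_mod_cast hl.ne'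
  have hG : DifferentiableOn ℂ (fun w => F ((l⁻¹ : ℝ) * w)) CPos := by
    refine hF.comp (by fun_prop) fun w hw => ?_
    exact (dilH l⁻¹ (inv_pos.2 hl) ⟨w, hw⟩).2
  have hsum := (summable_taylorCoeffI_smul_pow hG hlι).hasSum.tendsto_sum_nat
  obtain ⟨N, hN⟩ := ((Metric.tendsto_nhds.1 hsum) ε hε).exists
  let p : Polynomial ℂ := ∑ n ∈ Finset.range N,
    Polynomial.C (taylorCoeffI (fun w => F ((l⁻¹ : ℝ) * w)) n) *
      (Polynomial.C (l : ℂ) * Polynomial.X - Polynomial.C I) ^ n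
  refine ⟨_, eval_mem_of_monoH_mem (p := p) fun n _ => h n, fun z hz => ?_⟩
  rw [dist_comm, dist_eq_norm] at hN
  have := (ContinuousMap.norm_coe_le_norm _ (⟨z, hz⟩ : K)).trans hN.le
  rw [ContinuousMap.sub_apply, tsum_taylorCoeffI_smul_pow_apply hG hlι] at this
  convert! this using 3
  · rw [← hFf]
    congr 1
    simp [ι, Algebra.algebraMap_eq_smul_one]
    field_simp
  · simp [p, ι, Polynomial.eval_finsetSum, Algebra.algebraMap_eq_smul_one]

lemma taylorCoeffI_pow_ne_zero {m n : ℕ} (h : m ≤ n) : taylorCoeffI (fun z => z ^ n) m ≠ 0 := by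
  rw [taylorCoeffI, iteratedDeriv_eq_iterate, iter_deriv_pow]
  refine mul_ne_zero (by exact_mod_cast (inv_ne_zero (by exact_mod_cast m.factorial_ne_zero)))
    (mul_ne_zero ?_ (pow_ne_zero _ I_ne_zero))
  rw [Finset.prod_ne_zero_iff]
  intro i hi
  have : i < n := (Finset.mem_range.1 hi).trans_le h
  rw [sub_ne_zero]
  exact_mod_cast this.ne'

/-- A proper closed affinely invariant subspace of `Hol(ℂ₊)` is one of the `𝒫^k`. -/
lemma exists_eq_polyLtH {V : Submodule ℂ (↥CPos → ℂ)}
    (hholo : ∀ f ∈ V, HoloOnH f)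
    (hclosed : ∀ f, HoloOnH f → MemClosureH V f → f ∈ V)
    (hproper : ∃ f, HoloOnH f ∧ f ∉ V)
    (htrans : ∀ f ∈ V, ∀ x : ℝ, (fun z => f (transH x z)) ∈ V)
    (hdil : ∀ f ∈ V, ∀ (l : ℝ) (hl : 0 < l), (fun z => f (dilH l hl z)) ∈ V) :
    ∃ k, (V : Set (↥CPos → ℂ)) = PolyLtH k := by
  classical
  have hex : ∃ n, monoH n ∉ V := by
    by_contra! h
    obtain ⟨f, hf, hfV⟩ := hproper
    exact hfV (mem_of_forall_monoH_mem hclosed h hf)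
  refine ⟨Nat.find hex, Set.Subset.antisymm (fun f hf => ?_) ?_⟩
  · obtain ⟨F, hF, hFf⟩ := hholo f hf
    have hcoeff : ∀ n ≥ Nat.find hex, taylorCoeffI F n = 0 := by
      intro n hn
      by_contra h
      have h1 := monoH_mem_of_taylorCoeffI_ne_zero hclosed htrans hdil hf hF hFf h
      exact Nat.find_spec hex (monoH_mem_of_taylorCoeffI_ne_zero hclosed htrans hdil h1
        (F := fun z => z ^ n) (by fun_prop) (fun _ => rfl) (taylorCoeffI_pow_ne_zero hn))
    let p : Polynomial ℂ := ∑ n ∈ Finset.range (Nat.find hex),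
      Polynomial.C (taylorCoeffI F n) * (Polynomial.X - Polynomial.C I) ^ n
    have hball : ∀ z ∈ Metric.ball I 1, F z = p.eval z := by
      intro z hz
      have h1 := hasSum_taylorCoeffI hF (z := z) (by simpa [dist_eq_norm] using hz)
      have h2 := hasSum_sum_of_ne_finset_zero (s := Finset.range (Nat.find hex))
        (f := fun n => taylorCoeffI F n * (z - I) ^ n) (L := .unconditional ℕ) fun n hn => by
          rw [hcoeff n (by simpa using hn), zero_mul]
      rw [h1.unique h2]
      simp [p, Polynomial.eval_finsetSum]
    refine ⟨p, ?_, fun z => ?_⟩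
    · refine (Polynomial.degree_sum_le _ _).trans_lt ?_
      rw [Finset.sup_lt_iff (WithBot.bot_lt_coe _)]
      intro n hn
      rw [← Polynomial.smul_eq_C_mul]
      refine (Polynomial.degree_smul_le _ _).trans_lt ?_
      rw [Polynomial.degree_pow, Polynomial.degree_X_sub_C]
      simpa using hn
    · rw [← hFf]
      have h3 : I ∈ CPos := by simp [CPos]
      exact (hF.analyticOnNhd isOpen_CPos).eqOn_of_preconnected_of_eventuallyEq
        (p.differentiable.differentiableOn.analyticOnNhd isOpen_CPos) isPreconnected_CPos h3
        (Filter.eventually_of_mem (Metric.ball_mem_nhds I one_pos) hball) z.2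
  · rintro f ⟨p, hp, hfp⟩
    have hfp' : f = fun z : ↥CPos => p.eval (z : ℂ) := funext hfp
    rw [hfp']
    refine eval_mem_of_monoH_mem fun n hn => ?_
    have : (n : WithBot ℕ) < Nat.find hex := (Polynomial.le_degree_of_mem_supp n hn).trans_lt hp
    exact not_not.1 (Nat.find_min hex (by exact_mod_cast this))

lemma infinite_CPos : CPos.Infinite :=
  infinite_of_mem_nhds I (isOpen_CPos.mem_nhds (by simp [CPos]))

lemma polynomial_eq_of_eval_eq {p q : Polynomial ℂ} (h : ∀ z ∈ CPos, p.eval z = q.eval z) :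
    p = q :=
  Polynomial.eq_of_infinite_eval_eq p q (infinite_CPos.mono h)

lemma ne_zero_of_mem_CPos {z : ℂ} (hz : z ∈ CPos) : z ≠ 0 := by
  rintro rfl
  simp [CPos] at hz

/-- A power function that agrees with a polynomial on `ℂ₊` has a natural exponent. -/
lemma exists_nat_of_cpow_eq_eval {s : ℝ} {p : Polynomial ℂ}
    (h : ∀ z ∈ CPos, z ^ (-(s : ℂ)) = p.eval z) : ∃ j : ℕ, s = -(j : ℝ) := by
  have hp0 : p ≠ 0 := by
    rintro rfl
    have hI : I ∈ CPos := by simp [CPos]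
    have := h I hI
    simp [cpow_eq_zero_iff] at this
  have hcomp : p.comp (Polynomial.C 2 * Polynomial.X) =
      Polynomial.C ((2 : ℂ) ^ (-(s : ℂ))) * p := by
    refine polynomial_eq_of_eval_eq fun z hz => ?_
    have h2z := (dilH 2 two_pos ⟨z, hz⟩).2
    have hz0 := ne_zero_of_mem_CPos hz
    simp only [dilH] at h2z
    have h2 := h _ h2z
    simp only [Polynomial.eval_comp, Polynomial.eval_mul, Polynomial.eval_C, Polynomial.eval_X]
    rw [← h z hz, ← ofReal_ofNat, ← h2, cpow_def_of_ne_zero (mul_ne_zero (by simp) hz0),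
      cpow_def_of_ne_zero hz0, cpow_def_of_ne_zero (by simp), log_ofReal_mul two_pos hz0,
      ← Complex.exp_add, ofReal_log two_pos.le]
    ring_nf
  refine ⟨p.natDegree, ?_⟩
  have hc := congrArg (fun q => Polynomial.coeff q p.natDegree) hcomp
  simp only [Polynomial.comp_C_mul_X_coeff, Polynomial.coeff_C_mul,
    Polynomial.coeff_natDegree] at hc
  rw [mul_comm] at hc
  have hc' := mul_right_cancel₀ (Polynomial.leadingCoeff_ne_zero.2 hp0) hc
  have h3 : (2 : ℝ) ^ ((p.natDegree : ℝ)) = (2 : ℝ) ^ (-s) := by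
    rw [← Complex.ofReal_inj, ofReal_cpow two_pos.le, ofReal_cpow two_pos.le]
    simpa using hc'
  have h4 := (Real.rpow_right_inj two_pos (by norm_num)).1 h3
  linarith

/-- a proper closed affinely invariant subspace `V` of `Hol(ℂ₊)` is
invariant under the weighted inversion `T_s : f ↦ (z ↦ z^{-s} f(-1/z))` iff
`V = {0}`, or `s = -j` for some `j ∈ ℕ` and `V = 𝒫^{1+j}`. -/
theorem stmt_3 (s : ℝ) (V : Set (↥CPos → ℂ))
    (hVholo : ∀ f ∈ V, HoloOnH f)
    (hV0 : (0 : ↥CPos → ℂ) ∈ V)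
    (hVadd : ∀ f ∈ V, ∀ g ∈ V, f + g ∈ V)
    (hVsmul : ∀ (c : ℂ), ∀ f ∈ V, c • f ∈ V)
    (hVclosed : ∀ f, HoloOnH f → MemClosureH V f → f ∈ V)
    (hVproper : ∃ f, HoloOnH f ∧ f ∉ V)
    (hVtrans : ∀ f ∈ V, ∀ x : ℝ, (fun z => f (transH x z)) ∈ V)
    (hVdil : ∀ f ∈ V, ∀ (l : ℝ) (hl : 0 < l), (fun z => f (dilH l hl z)) ∈ V) :
    (∀ f ∈ V, (fun z : ↥CPos => (z : ℂ) ^ (-(s : ℂ)) * f (invH z)) ∈ V) ↔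
      (V = {(0 : ↥CPos → ℂ)} ∨ ∃ j : ℕ, s = -(j : ℝ) ∧ V = PolyLtH (j + 1)) := by
  constructor
  · intro hT
    let W : Submodule ℂ (↥CPos → ℂ) :=
      { carrier := V
        add_mem' := fun ha hb => hVadd _ ha _ hb
        zero_mem' := hV0
        smul_mem' := fun c _ hf => hVsmul c _ hf }
    obtain ⟨k, hk⟩ := exists_eq_polyLtH (V := W) hVholo hVclosed hVproper hVtrans hVdil
    change V = PolyLtH k at hk
    rcases k with - | k
    · left
      refine Set.eq_singleton_iff_unique_mem.2 ⟨hV0, fun f hf => ?_⟩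
      rw [hk] at hf
      obtain ⟨p, hp, hfp⟩ := hf
      have hp0 : p = 0 := by simpa using hp
      ext z
      simp [hfp, hp0]
    · right
      have h1 : monoH 0 ∈ V := by
        rw [hk]
        exact ⟨1, Polynomial.degree_one_le.trans_lt (by exact_mod_cast k.succ_pos),
          fun z => by simp [monoH]⟩
      have hk' : monoH k ∈ V := by
        rw [hk]
        refine ⟨Polynomial.X ^ k, ?_, fun z => by simp [monoH]⟩
        rw [Polynomial.degree_X_pow]
        exact_mod_cast k.lt_succ_self
      have hT1 := hT _ h1
      rw [hk] at hT1
      obtain ⟨p, hp, hpz⟩ := hT1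
      have hpz' : ∀ z ∈ CPos, z ^ (-(s : ℂ)) = p.eval z := fun z hz => by
        simpa [monoH] using hpz ⟨z, hz⟩
      obtain ⟨j, hj⟩ := exists_nat_of_cpow_eq_eval hpz'
      have hcpow : ∀ z : ℂ, z ^ (-(s : ℂ)) = z ^ j := fun z => by simp [hj]
      have hpX : p = Polynomial.X ^ j := polynomial_eq_of_eval_eq fun z hz => by
        rw [← hpz' z hz, hcpow]
        simp
      have hjk : j < k + 1 := by
        rw [hpX, Polynomial.degree_X_pow] at hp
        exact_mod_cast hp
      have hTk := hT _ hk'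
      rw [hk] at hTk
      obtain ⟨q, -, hqz⟩ := hTk
      have hq : Polynomial.C ((-1) ^ k) * Polynomial.X ^ j = q * Polynomial.X ^ k := by
        refine polynomial_eq_of_eval_eq fun z hz => ?_
        have hz0 := ne_zero_of_mem_CPos hz
        have h2 := hqz ⟨z, hz⟩
        simp only [hcpow, monoH, invH] at h2
        simp only [Polynomial.eval_mul, Polynomial.eval_C, Polynomial.eval_pow, Polynomial.eval_X,
          ← h2, div_pow]
        field_simp
      have hkj : k ≤ j := by
        by_contra! hlt
        have := congrArg (fun r => Polynomial.coeff r j) hq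
        simp only [Polynomial.coeff_mul_X_pow', hlt.not_ge, le_refl, if_true, if_false,
          Nat.sub_self, Polynomial.coeff_C_zero] at this
        exact pow_ne_zero k (neg_ne_zero.2 one_ne_zero) this
      obtain rfl : j = k := by omega
      exact ⟨j, hj, hk⟩
  · rintro (rfl | ⟨j, rfl, rfl⟩)
    · intro f hf
      rw [Set.mem_singleton_iff] at hf ⊢
      ext z
      simp [hf]
    · rintro f ⟨p, hp, hfp⟩
      have hpj : p.natDegree < j + 1 := by
        by_cases hp0 : p = 0
        · simp [hp0]
        · exact (Polynomial.natDegree_lt_iff_degree_lt hp0).2 hp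
      refine ⟨∑ n ∈ Finset.range (j + 1),
        Polynomial.C (p.coeff n * (-1) ^ n) * Polynomial.X ^ (j - n), ?_, fun z => ?_⟩
      · refine (Polynomial.degree_sum_le _ _).trans_lt ?_
        rw [Finset.sup_lt_iff (WithBot.bot_lt_coe _)]
        intro n _
        refine (Polynomial.degree_C_mul_X_pow_le _ _).trans_lt ?_
        exact_mod_cast Nat.lt_succ_of_le (Nat.sub_le j n)
      · have hz0 := ne_zero_of_mem_CPos z.2
        beta_reduce
        rw [hfp, Polynomial.eval_eq_sum_range' hpj, Polynomial.eval_finsetSum, Finset.mul_sum]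
        refine Finset.sum_congr rfl fun n hn => ?_
        have hnj : n ≤ j := Nat.lt_succ_iff.1 (Finset.mem_range.1 hn)
        simp only [invH, Polynomial.eval_mul, Polynomial.eval_C, Polynomial.eval_pow,
          Polynomial.eval_X, pow_sub₀ _ hz0 hnj, div_pow, ofReal_neg, ofReal_natCast, neg_neg,
          cpow_natCast]
        field_simp
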